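/- Let 1 < p < ∞, 0 < λ < p − 1, K = (λ/(p−1))^{1/p}, and y ∈ (0,π_p/2]. Define u_y : [0,π_p] → ℝ by u_y(x) = sin_p(Kx)/sin_p(Ky) for x ∈ [0,y] and u_y(x) = sin_p(K(π_p−x))/sin_p(K(π_p−y)) for x ∈ [y,π_p]. Then ∫₀^{π_p} |u_y′(x)|^p dx − λ∫₀^{π_p} |u_y(x)|^p dx = K^{p−1}·((cot_p(Ky))^{p−1} + |cot_p(K(π_p−y))|^{p−2}·cot_p(K(π_p−y))), where the integrals are taken piecewise on [0,y] and [y,π_p]. -/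

import Mathlib

/-- `arcsin_p x = ∫₀ˣ (1 - tᵖ)^(-1/p) dt`. -/
noncomputable def arcsinP (p x : ℝ) : ℝ := ∫ t in (0:ℝ)..x, (1 - t ^ p) ^ (-(1 / p))

/-- The generalized π: `π_p = 2 arcsin_p 1`. -/
noncomputable def piP (p : ℝ) : ℝ := 2 * arcsinP p 1

/-- `sin_p` on `[0, π_p/2]`, defined as the inverse of `arcsin_p : [0,1] → [0, π_p/2]`. -/
noncomputable def sinPHalf (p : ℝ) : ℝ → ℝ := Function.invFunOn (arcsinP p) (Set.Icc 0 1)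

/-- `sin_p` on `[0, π_p]`, extended by `sin_p x = sin_p (π_p - x)`. -/
noncomputable def sinP (p x : ℝ) : ℝ :=
  if x ≤ piP p / 2 then sinPHalf p x else sinPHalf p (piP p - x)

/-- `cos_p x = (1 - sin_p x ^ p)^(1/p)` on `[0, π_p/2]`, with minus sign on `[π_p/2, π_p]`. -/
noncomputable def cosP (p x : ℝ) : ℝ :=
  if x ≤ piP p / 2 then (1 - sinP p x ^ p) ^ (1 / p)
  else -((1 - sinP p x ^ p) ^ (1 / p))

/-- `cot_p x = cos_p x / sin_p x`. -/
noncomputable def cotP (p x : ℝ) : ℝ := cosP p x / sinP p x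

/-- The function `u_y(x) = sin_p (K x)/sin_p (K y)` on `[0, y]`,
`u_y(x) = sin_p (K (π_p - x))/sin_p (K (π_p - y))` on `[y, π_p]`. -/
noncomputable def uY (p K y x : ℝ) : ℝ :=
  if x ≤ y then sinP p (K * x) / sinP p (K * y)
  else sinP p (K * (piP p - x)) / sinP p (K * (piP p - y))


lemma asin_bound (p : ℝ) (hp : 1 < p) : IntervalIntegrable (fun t : ℝ => (1 - t ^ p) ^ (-(1 / p))) MeasureTheory.volume 0 1 := by
  have hq : 1 / p < 1 := by rw [div_lt_one (by linarith)]; exact hp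
  have hq0 : 0 < 1 / p := by positivity
  have h1 : IntervalIntegrable (fun t : ℝ => (1 - t) ^ (-(1 / p))) MeasureTheory.volume 0 1 := by
    have := (intervalIntegral.intervalIntegrable_rpow' (a := 0) (b := 1) (r := -(1/p)) (by linarith)).comp_sub_left 1
    simpa using this.symm
  refine h1.mono_fun ?_ ?_
  · apply Measurable.aestronglyMeasurable
    fun_prop
  · rw [Filter.EventuallyLE, MeasureTheory.ae_restrict_iff' measurableSet_uIoc]
    have : ∀ᵐ t : ℝ, t ≠ 1 := by simp [MeasureTheory.ae_iff]
    filter_upwards [this] with t ht1 ht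
    rw [Set.uIoc_of_le zero_le_one] at ht
    have ht' : t < 1 := lt_of_le_of_ne ht.2 ht1
    have h2 : t ^ p ≤ t := by
      simpa using Real.rpow_le_rpow_of_exponent_ge ht.1 ht.2 hp.le
    rw [Real.norm_of_nonneg (Real.rpow_nonneg (by linarith) _), Real.norm_of_nonneg (Real.rpow_nonneg (by linarith) _)]
    exact Real.rpow_le_rpow_of_nonpos (by linarith) (by linarith) (by linarith)

lemma asin_ii (p : ℝ) (hp : 1 < p) {a b : ℝ} (ha : a ∈ Set.Icc (0:ℝ) 1) (hb : b ∈ Set.Icc (0:ℝ) 1) :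
    IntervalIntegrable (fun t : ℝ => (1 - t ^ p) ^ (-(1 / p))) MeasureTheory.volume a b := by
  refine (asin_bound p hp).mono_set ?_
  rw [Set.uIcc_of_le zero_le_one]
  exact Set.uIcc_subset_Icc ha hb

lemma asin_expand (p : ℝ) (hp : 1 < p) {a b : ℝ} (ha : 0 ≤ a) (hab : a ≤ b) (hb : b ≤ 1) :
    b - a ≤ arcsinP p b - arcsinP p a := by
  have m0 : (0:ℝ) ∈ Set.Icc (0:ℝ) 1 := by simp
  have ma : a ∈ Set.Icc (0:ℝ) 1 := ⟨ha, hab.trans hb⟩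
  have mb : b ∈ Set.Icc (0:ℝ) 1 := ⟨ha.trans hab, hb⟩
  have h : arcsinP p b - arcsinP p a = ∫ t in a..b, (1 - t ^ p) ^ (-(1 / p)) := by
    unfold arcsinP
    exact intervalIntegral.integral_interval_sub_left (asin_ii p hp m0 mb) (asin_ii p hp m0 ma)
  have h1 : b - a = ∫ t in a..b, (1:ℝ) := by simp
  rw [h, h1]
  refine intervalIntegral.integral_mono_on_of_le_Ioo hab (by simp) (asin_ii p hp ma mb) ?_
  intro t ht
  have h0 : 0 < t := lt_of_le_of_lt ha ht.1
  have h3 : t ^ p < 1 := Real.rpow_lt_one h0.le (ht.2.trans_le hb) (by linarith)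
  have h4 : 0 ≤ t ^ p := Real.rpow_nonneg h0.le _
  refine Real.one_le_rpow_of_pos_of_le_one_of_nonpos (by linarith) (by linarith) ?_
  have : 0 < 1 / p := by positivity
  linarith

lemma asin_zero (p : ℝ) : arcsinP p 0 = 0 := by simp [arcsinP]

lemma asin_cont (p : ℝ) (hp : 1 < p) : ContinuousOn (arcsinP p) (Set.Icc 0 1) := by
  have := intervalIntegral.continuousOn_primitive_interval' (asin_bound p hp) (a := 0) (by simp)
  rwa [Set.uIcc_of_le zero_le_one] at this

lemma piP_half (p : ℝ) : piP p / 2 = arcsinP p 1 := by unfold piP; ring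

lemma piP_pos (p : ℝ) (hp : 1 < p) : 0 < piP p := by
  have := asin_expand p hp le_rfl zero_le_one le_rfl
  rw [asin_zero] at this
  unfold piP; linarith

lemma sh_spec (p : ℝ) (hp : 1 < p) {x : ℝ} (hx0 : 0 ≤ x) (hx : x ≤ piP p / 2) :
    sinPHalf p x ∈ Set.Icc (0:ℝ) 1 ∧ arcsinP p (sinPHalf p x) = x := by
  have : ∃ a ∈ Set.Icc (0:ℝ) 1, arcsinP p a = x := by
    have := intermediate_value_Icc zero_le_one (asin_cont p hp)
    rw [asin_zero, ← piP_half] at this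
    exact this ⟨hx0, hx⟩
  exact ⟨Function.invFunOn_mem this, Function.invFunOn_eq this⟩

lemma sh_lip (p : ℝ) (hp : 1 < p) : LipschitzOnWith 1 (sinPHalf p) (Set.Icc 0 (piP p / 2)) := by
  apply LipschitzOnWith.of_dist_le_mul
  intro x hx y hy
  obtain ⟨h1, h2⟩ := sh_spec p hp hx.1 hx.2
  obtain ⟨h3, h4⟩ := sh_spec p hp hy.1 hy.2
  simp only [NNReal.coe_one, one_mul, Real.dist_eq]
  rcases le_total (sinPHalf p x) (sinPHalf p y) with h | h
  · have := asin_expand p hp h1.1 h h3.2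
    rw [h2, h4] at this
    rw [abs_sub_comm, abs_of_nonneg (by linarith), abs_sub_comm, abs_of_nonneg (by linarith)]
    exact this
  · have := asin_expand p hp h3.1 h h1.2
    rw [h2, h4] at this
    rw [abs_of_nonneg (by linarith), abs_of_nonneg (by linarith)]
    exact this

lemma sh_pos (p : ℝ) (hp : 1 < p) {x : ℝ} (hx0 : 0 < x) (hx : x ≤ piP p / 2) : 0 < sinPHalf p x := by
  obtain ⟨h1, h2⟩ := sh_spec p hp hx0.le hx
  refine lt_of_le_of_ne h1.1 fun h => ?_
  rw [← h, asin_zero] at h2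
  linarith

lemma sh_lt (p : ℝ) (hp : 1 < p) {x : ℝ} (hx0 : 0 ≤ x) (hx : x < piP p / 2) : sinPHalf p x < 1 := by
  obtain ⟨h1, h2⟩ := sh_spec p hp hx0 hx.le
  refine lt_of_le_of_ne h1.2 fun h => ?_
  rw [h, ← piP_half] at h2
  linarith

lemma sh_end (p : ℝ) (hp : 1 < p) : sinPHalf p (piP p / 2) = 1 := by
  have hpi := piP_pos p hp
  obtain ⟨h1, h2⟩ := sh_spec p hp (x := piP p / 2) (by linarith) le_rfl
  have := asin_expand p hp h1.1 h1.2 le_rfl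
  rw [h2, ← piP_half] at this
  linarith [h1.2]

lemma sh_zero (p : ℝ) (hp : 1 < p) : sinPHalf p 0 = 0 := by
  have hpi := piP_pos p hp
  obtain ⟨h1, h2⟩ := sh_spec p hp (x := 0) le_rfl (by linarith)
  have := asin_expand p hp le_rfl h1.1 h1.2
  rw [h2, asin_zero] at this
  linarith [h1.1]

lemma asin_deriv (p : ℝ) (hp : 1 < p) {x : ℝ} (hx0 : 0 < x) (hx : x < 1) :
    HasDerivAt (arcsinP p) ((1 - x ^ p) ^ (-(1 / p))) x := by
  have h3 : x ^ p < 1 := Real.rpow_lt_one hx0.le hx (by linarith)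
  refine intervalIntegral.integral_hasDerivAt_right (asin_ii p hp (by simp) ⟨hx0.le, hx.le⟩) ?_ ?_
  · have hm : Measurable (fun t : ℝ => (1 - t ^ p) ^ (-(1 / p))) := by fun_prop
    exact hm.stronglyMeasurable.stronglyMeasurableAtFilter
  · refine ContinuousAt.rpow_const ?_ (Or.inl (by linarith))
    exact continuousAt_const.sub (Real.continuousAt_rpow_const _ _ (Or.inl hx0.ne'))

lemma sh_deriv (p : ℝ) (hp : 1 < p) {x : ℝ} (hx0 : 0 < x) (hx : x < piP p / 2) :
    HasDerivAt (sinPHalf p) ((1 - sinPHalf p x ^ p) ^ (1 / p)) x := by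
  have s0 := sh_pos p hp hx0 hx.le
  have s1 := sh_lt p hp hx0.le hx
  have h3 : sinPHalf p x ^ p < 1 := Real.rpow_lt_one s0.le s1 (by linarith)
  have hd := asin_deriv p hp s0 s1
  have hn : Set.Icc 0 (piP p / 2) ∈ nhds x := Icc_mem_nhds hx0 hx
  have hc : ContinuousAt (sinPHalf p) x := (sh_lip p hp).continuousOn.continuousAt hn
  have := HasDerivAt.of_local_left_inverse hc hd (Real.rpow_pos_of_pos (by linarith) _).ne' (by
    filter_upwards [hn] with z hz
    exact (sh_spec p hp hz.1 hz.2).2)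
  rwa [Real.rpow_neg (by linarith), inv_inv] at this

lemma sinP_eq (p x : ℝ) : sinP p x = sinPHalf p (min x (piP p - x)) := by
  unfold sinP
  split_ifs with h
  · rw [min_eq_left (by linarith)]
  · rw [min_eq_right (by linarith)]

lemma sinP_mem (p : ℝ) (hp : 1 < p) {x : ℝ} (hx : x ∈ Set.Icc 0 (piP p)) : sinP p x ∈ Set.Icc (0:ℝ) 1 := by
  rw [sinP_eq]
  have : min x (piP p - x) ≤ piP p / 2 := by
    rcases le_total x (piP p / 2) with h | h
    · exact (min_le_left _ _).trans h
    · exact (min_le_right _ _).trans (by linarith)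
  exact (sh_spec p hp (le_min hx.1 (by linarith [hx.2])) this).1

lemma sinP_pos (p : ℝ) (hp : 1 < p) {x : ℝ} (hx : x ∈ Set.Ioo 0 (piP p)) : 0 < sinP p x := by
  rw [sinP_eq]
  have : min x (piP p - x) ≤ piP p / 2 := by
    rcases le_total x (piP p / 2) with h | h
    · exact (min_le_left _ _).trans h
    · exact (min_le_right _ _).trans (by linarith)
  exact (sh_pos p hp (lt_min hx.1 (by linarith [hx.2])) this)

lemma sinP_cont (p : ℝ) (hp : 1 < p) : ContinuousOn (sinP p) (Set.Icc 0 (piP p)) := by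
  have : sinP p = fun x => sinPHalf p (min x (piP p - x)) := funext (sinP_eq p)
  rw [this]
  refine (sh_lip p hp).continuousOn.comp (by fun_prop) ?_
  intro x hx
  refine ⟨le_min hx.1 (by linarith [hx.2]), ?_⟩
  rcases le_total x (piP p / 2) with h | h
  · exact (min_le_left _ _).trans h
  · exact (min_le_right _ _).trans (by linarith)

lemma sinP_pow_le (p : ℝ) (hp : 1 < p) {x : ℝ} (hx : x ∈ Set.Icc 0 (piP p)) : sinP p x ^ p ≤ 1 := by
  have := sinP_mem p hp hx
  exact Real.rpow_le_one this.1 this.2 (by linarith)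

lemma sinP_mid (p : ℝ) (hp : 1 < p) : sinP p (piP p / 2) = 1 := by
  simp [sinP, sh_end p hp]

lemma sinP_pow_lt (p : ℝ) (hp : 1 < p) {x : ℝ} (hx : x ∈ Set.Icc 0 (piP p)) (hne : x ≠ piP p / 2) :
    sinP p x ^ p < 1 := by
  have := sinP_mem p hp hx
  refine Real.rpow_lt_one this.1 ?_ (by linarith)
  unfold sinP
  split_ifs with h
  · exact sh_lt p hp hx.1 (lt_of_le_of_ne h hne)
  · exact sh_lt p hp (by linarith [hx.2]) (by linarith)

lemma sinP_deriv (p : ℝ) (hp : 1 < p) {x : ℝ} (hx : x ∈ Set.Ioo 0 (piP p)) (hne : x ≠ piP p / 2) :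
    HasDerivAt (sinP p) (cosP p x) x := by
  rcases lt_or_gt_of_ne hne with h | h
  · have h1 := sh_deriv p hp hx.1 h
    have e : sinP p =ᶠ[nhds x] sinPHalf p := by
      filter_upwards [Iio_mem_nhds h] with z hz
      exact if_pos (le_of_lt hz)
    have e2 : cosP p x = (1 - sinPHalf p x ^ p) ^ (1 / p) := by
      rw [cosP, if_pos h.le, e.eq_of_nhds]
    rw [e2]
    exact h1.congr_of_eventuallyEq e
  · have h1 := sh_deriv p hp (x := piP p - x) (by linarith [hx.2]) (by linarith)
    have e : sinP p =ᶠ[nhds x] fun z => sinPHalf p (piP p - z) := by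
      filter_upwards [Ioi_mem_nhds h] with z hz
      exact if_neg (not_le.2 hz)
    have e2 : cosP p x = -(1 - sinPHalf p (piP p - x) ^ p) ^ (1 / p) := by
      rw [cosP, if_neg (not_le.2 h), e.eq_of_nhds]
    rw [e2]
    exact (HasDerivAt.comp_const_sub (piP p) x h1).congr_of_eventuallyEq e

noncomputable def phiP (p x : ℝ) : ℝ := |cosP p x| ^ (p - 2) * cosP p x

lemma abs_cos_pow (p : ℝ) (hp : 1 < p) {x : ℝ} (hx : x ∈ Set.Icc 0 (piP p)) :
    |cosP p x| ^ p = 1 - sinP p x ^ p := by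
  have h := sinP_pow_le p hp hx
  have h' : 0 ≤ (1 - sinP p x ^ p) ^ (1 / p) := Real.rpow_nonneg (by linarith) _
  have : |cosP p x| = (1 - sinP p x ^ p) ^ (1 / p) := by
    unfold cosP
    split_ifs
    · exact abs_of_nonneg h'
    · rw [abs_neg]; exact abs_of_nonneg h'
  rw [this, ← Real.rpow_mul (by linarith), one_div, inv_mul_cancel₀ (by linarith), Real.rpow_one]

lemma phi_aux (p : ℝ) (hp : 1 < p) {r : ℝ} (hr : 0 ≤ r) :
    |r ^ (1 / p)| ^ (p - 2) * r ^ (1 / p) = r ^ ((p - 1) / p) := by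
  have hp0 : p ≠ 0 := by linarith
  rcases hr.eq_or_lt with rfl | hr
  · rw [Real.zero_rpow (x := 1 / p) (by positivity), Real.zero_rpow (x := (p - 1) / p) (div_pos (by linarith) (by linarith)).ne', mul_zero]
  · rw [abs_of_nonneg (by positivity), ← Real.rpow_mul hr.le, ← Real.rpow_add hr]
    congr 1
    field_simp
    ring

lemma phi_left (p : ℝ) (hp : 1 < p) {x : ℝ} (hx : x ∈ Set.Icc 0 (piP p)) (h : x ≤ piP p / 2) :
    phiP p x = (1 - sinP p x ^ p) ^ ((p - 1) / p) := by
  rw [phiP, cosP, if_pos h, phi_aux p hp (by linarith [sinP_pow_le p hp hx])]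

lemma phi_right (p : ℝ) (hp : 1 < p) {x : ℝ} (hx : x ∈ Set.Icc 0 (piP p)) (h : piP p / 2 ≤ x) :
    phiP p x = -(1 - sinP p x ^ p) ^ ((p - 1) / p) := by
  rcases h.eq_or_lt with h | h
  · rw [phi_left p hp hx h.symm.le, ← h, sinP_mid p hp, Real.one_rpow, sub_self,
      Real.zero_rpow (div_pos (by linarith) (by linarith)).ne', neg_zero]
  · rw [phiP, cosP, if_neg (not_le.2 h), abs_neg, mul_neg, phi_aux p hp (by linarith [sinP_pow_le p hp hx])]

lemma phi_cont (p : ℝ) (hp : 1 < p) : ContinuousOn (phiP p) (Set.Icc 0 (piP p)) := by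
  have hpi := piP_pos p hp
  have hc : ContinuousOn (fun x => (1 - sinP p x ^ p) ^ ((p - 1) / p)) (Set.Icc 0 (piP p)) := by
    refine ContinuousOn.rpow_const (continuousOn_const.sub ((sinP_cont p hp).rpow_const fun _ _ => Or.inr (by linarith))) fun _ _ => Or.inr (div_pos (by linarith) (by linarith)).le
  have hu : Set.Icc 0 (piP p) = Set.Icc 0 (piP p / 2) ∪ Set.Icc (piP p / 2) (piP p) :=
    (Set.Icc_union_Icc_eq_Icc (by linarith) (by linarith)).symm
  have sl : Set.Icc 0 (piP p / 2) ⊆ Set.Icc 0 (piP p) := Set.Icc_subset_Icc le_rfl (by linarith)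
  have sr : Set.Icc (piP p / 2) (piP p) ⊆ Set.Icc 0 (piP p) := Set.Icc_subset_Icc (by linarith) le_rfl
  rw [hu]
  refine ContinuousOn.union_of_isClosed ?_ ?_ isClosed_Icc isClosed_Icc
  · exact (hc.mono sl).congr fun x hx => phi_left p hp (sl hx) hx.2
  · exact (hc.mono sr).neg.congr fun x hx => phi_right p hp (sr hx) hx.1

lemma phi_deriv (p : ℝ) (hp : 1 < p) {x : ℝ} (hx : x ∈ Set.Ioo 0 (piP p)) (hne : x ≠ piP p / 2) :
    HasDerivAt (phiP p) (-(p - 1) * sinP p x ^ (p - 1)) x := by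
  have hs := sinP_pos p hp hx
  have hr := sinP_pow_lt p hp (Set.Ioo_subset_Icc_self hx) hne
  have hr' : 0 < 1 - sinP p x ^ p := by linarith
  have hd := sinP_deriv p hp hx hne
  have hp0 : p ≠ 0 := by linarith
  have hb : HasDerivAt (fun x => (1 - sinP p x ^ p) ^ ((p - 1) / p)) _ x :=
    ((hd.rpow_const (p := p) (Or.inl hs.ne')).const_sub 1).rpow_const (p := (p - 1) / p) (Or.inl hr'.ne')
  have hk : (1 - sinP p x ^ p) ^ (1 / p) * (1 - sinP p x ^ p) ^ ((p - 1) / p - 1) = 1 := by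
    rw [← Real.rpow_add hr']
    have : 1 / p + ((p - 1) / p - 1) = 0 := by field_simp; ring
    rw [this, Real.rpow_zero]
  rcases lt_or_gt_of_ne hne with h | h
  · have e : phiP p =ᶠ[nhds x] fun x => (1 - sinP p x ^ p) ^ ((p - 1) / p) := by
      filter_upwards [Iio_mem_nhds h, Ioo_mem_nhds hx.1 hx.2] with z hz hz'
      exact phi_left p hp (Set.Ioo_subset_Icc_self hz') (le_of_lt hz)
    refine (hb.congr_of_eventuallyEq e).congr_deriv ?_
    rw [cosP, if_pos h.le]
    have : p * ((p - 1) / p) = p - 1 := by field_simp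
    linear_combination (-(p * ((p - 1) / p)) * sinP p x ^ (p - 1)) * hk - sinP p x ^ (p - 1) * this
  · have e : phiP p =ᶠ[nhds x] fun x => -(1 - sinP p x ^ p) ^ ((p - 1) / p) := by
      filter_upwards [Ioi_mem_nhds h, Ioo_mem_nhds hx.1 hx.2] with z hz hz'
      exact phi_right p hp (Set.Ioo_subset_Icc_self hz') (le_of_lt hz)
    refine (hb.neg.congr_of_eventuallyEq e).congr_deriv ?_
    rw [cosP, if_neg (not_le.2 h)]
    have : p * ((p - 1) / p) = p - 1 := by field_simp
    linear_combination (-(p * ((p - 1) / p)) * sinP p x ^ (p - 1)) * hk - sinP p x ^ (p - 1) * this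

lemma core (p K a : ℝ) (hp : 1 < p) (hK0 : 0 < K) (ha : 0 < a) (hKa : K * a < piP p) :
    ∫ x in (0:ℝ)..a, (1 - sinP p (K * x) ^ p - (p - 1) * sinP p (K * x) ^ p) =
      K⁻¹ * (phiP p (K * a) * sinP p (K * a)) := by
  have hpi := piP_pos p hp
  have hm : Set.MapsTo (fun x => K * x) (Set.Icc 0 a) (Set.Icc 0 (piP p)) := by
    intro x hx
    exact ⟨mul_nonneg hK0.le hx.1, (mul_le_mul_of_nonneg_left hx.2 hK0.le).trans hKa.le⟩
  have cs : ContinuousOn (fun x => sinP p (K * x)) (Set.Icc 0 a) := (sinP_cont p hp).comp (by fun_prop) hm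
  have cph : ContinuousOn (fun x => phiP p (K * x)) (Set.Icc 0 a) := (phi_cont p hp).comp (by fun_prop) hm
  have csp : ContinuousOn (fun x => sinP p (K * x) ^ p) (Set.Icc 0 a) :=
    cs.rpow_const fun _ _ => Or.inr (by linarith)
  have := MeasureTheory.integral_eq_of_hasDerivAt_off_countable
    (fun x => K⁻¹ * (phiP p (K * x) * sinP p (K * x)))
    (fun x => (1 - sinP p (K * x) ^ p - (p - 1) * sinP p (K * x) ^ p)) (a := 0) (b := a)
    (s := {K⁻¹ * (piP p / 2)}) (Set.countable_singleton _)
    (by rw [Set.uIcc_of_le ha.le]; exact continuousOn_const.mul (cph.mul cs))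
    (by
      rintro x ⟨hx, hxn⟩
      rw [min_eq_left ha.le, max_eq_right ha.le] at hx
      have hne : K * x ≠ piP p / 2 := by
        intro h; apply hxn; rw [Set.mem_singleton_iff, ← h]; field_simp
      have hx' : K * x ∈ Set.Ioo 0 (piP p) := ⟨mul_pos hK0 hx.1, (mul_lt_mul_of_pos_left hx.2 hK0).trans hKa⟩
      have hs := sinP_pos p hp hx'
      have hr := sinP_pow_lt p hp (Set.Ioo_subset_Icc_self hx') hne
      have hl : HasDerivAt (fun x => K * x) K x := by simpa using (hasDerivAt_id x).const_mul K
      have d1 := (phi_deriv p hp hx' hne).comp x hl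
      have d2 := (sinP_deriv p hp hx' hne).comp x hl
      have := (d1.mul d2).const_mul K⁻¹
      refine this.congr_deriv ?_
      simp only [Function.comp_apply]
      have e1 : phiP p (K * x) * cosP p (K * x) = 1 - sinP p (K * x) ^ p := by
        rw [← abs_cos_pow p hp (Set.Ioo_subset_Icc_self hx'), phiP]
        have hc : 0 < |cosP p (K * x)| := by
          have := abs_cos_pow p hp (Set.Ioo_subset_Icc_self hx')
          refine lt_of_le_of_ne (abs_nonneg _) fun h => ?_
          rw [← h, Real.zero_rpow (by linarith)] at this
          linarith
        have : |cosP p (K * x)| ^ p = |cosP p (K * x)| ^ (p - 2) * cosP p (K * x) ^ 2 := by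
          rw [← sq_abs (cosP p (K * x)), ← Real.rpow_two, ← Real.rpow_add hc]; congr 1; ring
        rw [this]
        ring
      have e2 : sinP p (K * x) ^ (p - 1) * sinP p (K * x) = sinP p (K * x) ^ p := by
        rw [Real.rpow_sub_one hs.ne']; field_simp
      rw [← e1, ← e2]
      field_simp
      ring)
    (by
      apply ContinuousOn.intervalIntegrable
      rw [Set.uIcc_of_le ha.le]
      exact (continuousOn_const.sub csp).sub (continuousOn_const.mul csp))
  rw [this]
  have h0 : sinP p (K * 0) = 0 := by
    rw [mul_zero, sinP, if_pos (by linarith), sh_zero p hp]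
  rw [h0]; ring

lemma cot_phi (p : ℝ) (hp : 1 < p) {x : ℝ} (hx : x ∈ Set.Ioo 0 (piP p)) :
    |cotP p x| ^ (p - 2) * cotP p x = phiP p x * sinP p x / sinP p x ^ p := by
  have hs := sinP_pos p hp hx
  rw [cotP, phiP, abs_div, abs_of_pos hs, Real.div_rpow (abs_nonneg _) hs.le]
  have : sinP p x ^ p = sinP p x ^ (p - 2) * sinP p x ^ 2 := by
    rw [← Real.rpow_two, ← Real.rpow_add hs]; congr 1; ring
  rw [this]
  have := (Real.rpow_pos_of_pos hs (p - 2)).ne'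
  field_simp

/-- One piece. -/
lemma piece (p lam K a : ℝ) (hp : 1 < p) (hK0 : 0 < K) (hlam : lam = (p - 1) * K ^ p) (ha : 0 < a)
    (hKa : K * a < piP p) :
    IntervalIntegrable (fun x => |K * cosP p (K * x) / sinP p (K * a)| ^ p) MeasureTheory.volume 0 a ∧
    IntervalIntegrable (fun x => |sinP p (K * x) / sinP p (K * a)| ^ p) MeasureTheory.volume 0 a ∧
    (∫ x in (0:ℝ)..a, |K * cosP p (K * x) / sinP p (K * a)| ^ p) -
      lam * (∫ x in (0:ℝ)..a, |sinP p (K * x) / sinP p (K * a)| ^ p) =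
      K ^ (p - 1) * (|cotP p (K * a)| ^ (p - 2) * cotP p (K * a)) := by
  have hKm : K * a ∈ Set.Ioo 0 (piP p) := ⟨mul_pos hK0 ha, hKa⟩
  have hs := sinP_pos p hp hKm
  have hm : Set.MapsTo (fun x => K * x) (Set.Icc 0 a) (Set.Icc 0 (piP p)) := by
    intro x hx
    exact ⟨mul_nonneg hK0.le hx.1, (mul_le_mul_of_nonneg_left hx.2 hK0.le).trans hKa.le⟩
  have csp : ContinuousOn (fun x => sinP p (K * x) ^ p) (Set.Icc 0 a) :=
    ((sinP_cont p hp).comp (by fun_prop) hm).rpow_const fun _ _ => Or.inr (by linarith)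
  have e1 : Set.EqOn (fun x => |K * cosP p (K * x) / sinP p (K * a)| ^ p)
      (fun x => K ^ p / sinP p (K * a) ^ p * (1 - sinP p (K * x) ^ p)) (Set.Icc 0 a) := by
    intro x hx
    simp only
    rw [← abs_cos_pow p hp (hm hx), abs_div, abs_mul, abs_of_pos hK0, abs_of_pos hs,
      Real.div_rpow (by positivity) hs.le, Real.mul_rpow hK0.le (abs_nonneg _)]
    ring
  have e2 : Set.EqOn (fun x => |sinP p (K * x) / sinP p (K * a)| ^ p)
      (fun x => 1 / sinP p (K * a) ^ p * (sinP p (K * x) ^ p)) (Set.Icc 0 a) := by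
    intro x hx
    have := (sinP_mem p hp (hm hx)).1
    simp only at this ⊢
    rw [abs_div, abs_of_nonneg this, abs_of_pos hs, Real.div_rpow this hs.le]
    ring
  have u := Set.uIcc_of_le ha.le
  have i0 : IntervalIntegrable (fun x => sinP p (K * x) ^ p) MeasureTheory.volume 0 a := by
    apply ContinuousOn.intervalIntegrable; rwa [u]
  have i1 : IntervalIntegrable (fun x => 1 - sinP p (K * x) ^ p) MeasureTheory.volume 0 a :=
    intervalIntegrable_const.sub i0
  refine ⟨?_, ?_, ?_⟩
  · apply ContinuousOn.intervalIntegrable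
    rw [u]
    exact (continuousOn_const.mul (continuousOn_const.sub csp)).congr e1
  · apply ContinuousOn.intervalIntegrable
    rw [u]
    exact (continuousOn_const.mul csp).congr e2
  · rw [← u] at e1 e2
    rw [intervalIntegral.integral_congr e1, intervalIntegral.integral_congr e2,
      intervalIntegral.integral_const_mul, intervalIntegral.integral_const_mul]
    have c := core p K a hp hK0 ha hKa
    rw [intervalIntegral.integral_sub i1 (i0.const_mul _), intervalIntegral.integral_const_mul] at c
    rw [cot_phi p hp hKm, Real.rpow_sub_one hK0.ne', hlam]
    linear_combination (K ^ p / sinP p (K * a) ^ p) * c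

/-- For `0 < λ < p-1`, `K = (λ/(p-1))^(1/p)` and `y ∈ (0, π_p/2]`,
`∫ |u_y'|^p - λ ∫ |u_y|^p
  = K^(p-1) ((cot_p (K y))^(p-1) + |cot_p (K(π_p - y))|^(p-2) cot_p (K(π_p - y)))`. -/
theorem J_uY_eq (p lam K y : ℝ) (hp : 1 < p)
    (hlam0 : 0 < lam) (hlam1 : lam < p - 1)
    (hK : K = (lam / (p - 1)) ^ (1 / p))
    (hy0 : 0 < y) (hy : y ≤ piP p / 2) :
    (∫ x in (0:ℝ)..piP p, |deriv (uY p K y) x| ^ p) -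
        lam * ∫ x in (0:ℝ)..piP p, |uY p K y x| ^ p =
      K ^ (p - 1) * ((cotP p (K * y)) ^ (p - 1) +
        |cotP p (K * (piP p - y))| ^ (p - 2) * cotP p (K * (piP p - y))) := by
  have hpi := piP_pos p hp
  have hq : 0 < lam / (p - 1) := div_pos hlam0 (by linarith)
  have hK0 : 0 < K := by rw [hK]; exact Real.rpow_pos_of_pos hq _
  have hK1 : K < 1 := by
    rw [hK]
    exact Real.rpow_lt_one hq.le (by rw [div_lt_one (by linarith)]; exact hlam1) (by positivity)
  have hlam : lam = (p - 1) * K ^ p := by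
    have : p - 1 ≠ 0 := by linarith
    rw [hK, ← Real.rpow_mul hq.le, one_div, inv_mul_cancel₀ (by linarith), Real.rpow_one]
    field_simp
  have hb0 : 0 < piP p - y := by linarith
  have hKy : K * y < piP p / 2 := by nlinarith
  have hKb : K * (piP p - y) < piP p := by nlinarith
  obtain ⟨A1, A2, A3⟩ := piece p lam K y hp hK0 hlam hy0 (by linarith)
  obtain ⟨B1, B2, B3⟩ := piece p lam K (piP p - y) hp hK0 hlam hb0 hKb
  have C1 := (B1.comp_sub_left (piP p)).symm
  have C2 := (B2.comp_sub_left (piP p)).symm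
  simp only [sub_sub_cancel, sub_zero] at C1 C2
  have D1 := intervalIntegral.integral_comp_sub_left (a := y) (b := piP p)
    (fun x => |K * cosP p (K * x) / sinP p (K * (piP p - y))| ^ p) (piP p)
  have D2 := intervalIntegral.integral_comp_sub_left (a := y) (b := piP p)
    (fun x => |sinP p (K * x) / sinP p (K * (piP p - y))| ^ p) (piP p)
  simp only [sub_self] at D1 D2
  rw [← D1, ← D2] at B3
  have hyp : y < piP p := by linarith
  have hl : ∀ x c : ℝ, HasDerivAt (fun x => K * x + c) K x := fun x c => by
    simpa using ((hasDerivAt_id x).const_mul K).add_const c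
  have E1 : ∀ᵐ x : ℝ, x ∈ Set.uIoc 0 y → |K * cosP p (K * x) / sinP p (K * y)| ^ p = |deriv (uY p K y) x| ^ p := by
    have : ∀ᵐ x : ℝ, x ≠ y := by simp [MeasureTheory.ae_iff]
    filter_upwards [this] with x hx1 hx
    rw [Set.uIoc_of_le hy0.le] at hx
    have hxy : x < y := lt_of_le_of_ne hx.2 hx1
    have hlt : K * x < piP p / 2 := (mul_lt_mul_of_pos_left hxy hK0).trans hKy
    have e : uY p K y =ᶠ[nhds x] fun x => sinP p (K * x) / sinP p (K * y) := by
      filter_upwards [Iio_mem_nhds hxy] with z hz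
      exact if_pos (le_of_lt hz)
    have d := ((sinP_deriv p hp ⟨mul_pos hK0 hx.1, by linarith⟩ hlt.ne).comp x
      (by simpa using hl x 0 : HasDerivAt (fun x => K * x) K x)).div_const (sinP p (K * y))
    rw [(d.congr_of_eventuallyEq e).deriv, mul_comm K (cosP _ _)]
  have E2 : ∀ᵐ x : ℝ, x ∈ Set.uIoc 0 y → |sinP p (K * x) / sinP p (K * y)| ^ p = |uY p K y x| ^ p := by
    filter_upwards with x hx
    rw [Set.uIoc_of_le hy0.le] at hx
    rw [uY, if_pos hx.2]
  have F1 : ∀ᵐ x : ℝ, x ∈ Set.uIoc y (piP p) →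
      |K * cosP p (K * (piP p - x)) / sinP p (K * (piP p - y))| ^ p = |deriv (uY p K y) x| ^ p := by
    have t1 : ∀ᵐ x : ℝ, x ≠ piP p := by simp [MeasureTheory.ae_iff]
    have t2 : ∀ᵐ x : ℝ, x ≠ piP p - K⁻¹ * (piP p / 2) := by simp [MeasureTheory.ae_iff]
    filter_upwards [t1, t2] with x hx1 hx2 hx
    rw [Set.uIoc_of_le hyp.le] at hx
    have hxp : x < piP p := lt_of_le_of_ne hx.2 hx1
    have hne : K * (piP p - x) ≠ piP p / 2 := by
      intro h; apply hx2; rw [← h]; field_simp; ring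
    have hlt : K * (piP p - x) < piP p :=
      (mul_lt_mul_of_pos_left (by linarith [hx.1]) hK0).trans hKb
    have e : uY p K y =ᶠ[nhds x] fun x => sinP p (K * (piP p - x)) / sinP p (K * (piP p - y)) := by
      filter_upwards [Ioi_mem_nhds hx.1] with z hz
      exact if_neg (not_le.2 hz)
    have d := ((sinP_deriv p hp ⟨mul_pos hK0 (by linarith), hlt⟩ hne).comp x
      (by simpa using ((hasDerivAt_id x).const_sub (piP p)).const_mul K :
        HasDerivAt (fun x => K * (piP p - x)) (-K) x)).div_const (sinP p (K * (piP p - y)))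
    rw [(d.congr_of_eventuallyEq e).deriv, mul_neg, neg_div, abs_neg, mul_comm K (cosP _ _)]
  have F2 : ∀ᵐ x : ℝ, x ∈ Set.uIoc y (piP p) →
      |sinP p (K * (piP p - x)) / sinP p (K * (piP p - y))| ^ p = |uY p K y x| ^ p := by
    filter_upwards with x hx
    rw [Set.uIoc_of_le hyp.le] at hx
    rw [uY, if_neg (not_le.2 hx.1)]
  have tr : ∀ {f g : ℝ → ℝ} {a b : ℝ}, (∀ᵐ x : ℝ, x ∈ Set.uIoc a b → f x = g x) →
      IntervalIntegrable f MeasureTheory.volume a b → IntervalIntegrable g MeasureTheory.volume a b := by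
    intro f g a b h hf
    exact hf.congr_ae ((MeasureTheory.ae_restrict_iff' measurableSet_uIoc).2 h)
  rw [intervalIntegral.integral_congr_ae E1, intervalIntegral.integral_congr_ae E2] at A3
  rw [intervalIntegral.integral_congr_ae F1, intervalIntegral.integral_congr_ae F2] at B3
  rw [← intervalIntegral.integral_add_adjacent_intervals (tr E1 A1) (tr F1 C1),
    ← intervalIntegral.integral_add_adjacent_intervals (tr E2 A2) (tr F2 C2)]
  have hcot : cotP p (K * y) ^ (p - 1) = |cotP p (K * y)| ^ (p - 2) * cotP p (K * y) := by
    have hm : K * y ∈ Set.Ioo 0 (piP p) := ⟨mul_pos hK0 hy0, by linarith⟩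
    have hc : 0 < cotP p (K * y) := by
      have := sinP_pow_lt p hp (Set.Ioo_subset_Icc_self hm) hKy.ne
      rw [cotP, cosP, if_pos hKy.le]
      exact div_pos (Real.rpow_pos_of_pos (by linarith) _) (sinP_pos p hp hm)
    rw [abs_of_pos hc, ← Real.rpow_add_one hc.ne']
    congr 1; ring
  rw [hcot]
  linear_combination A3 + B3
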